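/- Let A, B, C, D be abelian groups and let f : A → B, g : B → ℤ, h : ℤ → C, k : C → D be group homomorphisms such that the sequence 0 → A →f→ B →g→ ℤ →·χ→ ℤ →h→ C →k→ D → 0 is exact, where the middle map ℤ → ℤ is multiplication by a nonzero integer χ. If D is a free abelian group, then f : A → B is an isomorphism and C is isomorphic to (ℤ/|χ|ℤ) × D. -/

import Mathlib

/-- A short exact sequence `0 → N → C → D → 0` of abelian groups with `D` free splits. -/
theorem nonempty_addEquiv_prod_of_exact_of_free {N C D : Type*} [AddCommGroup N]
    [AddCommGroup C] [AddCommGroup D] [Module.Free ℤ D] (i : N →+ C) (k : C →+ D)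
    (hi : Function.Injective i) (hik : i.range = k.ker) (hk : Function.Surjective k) :
    Nonempty (C ≃+ N × D) := by
  obtain ⟨s, hs⟩ := Module.projective_lifting_property k.toIntLinearMap LinearMap.id hk
  have hexact : Function.Exact i.toIntLinearMap k.toIntLinearMap := fun c => by
    simpa using (SetLike.ext_iff.mp hik c).symm
  exact ⟨(hexact.splitSurjectiveEquiv hi ⟨s, hs⟩).1.toAddEquiv⟩

/-- The image of a homomorphism out of `ℤ` with kernel `χℤ` is an embedded copy of `ℤ/|χ|ℤ`. -/
theorem exists_injective_zmod_of_ker_eq {C : Type*} [AddCommGroup C] (h : ℤ →+ C) (χ : ℤ)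
    (hχh : (zsmulAddGroupHom χ : ℤ →+ ℤ).range = h.ker) :
    ∃ i : ZMod χ.natAbs →+ C, Function.Injective i ∧ i.range = h.range := by
  have hker (m : ℤ) : h m = 0 ↔ χ ∣ m := by
    rw [← AddMonoidHom.mem_ker, ← hχh]
    simp [AddMonoidHom.mem_range, Dvd.dvd, eq_comm]
  refine ⟨ZMod.lift χ.natAbs ⟨h, (hker _).2 Int.dvd_natAbs_self⟩, ?_, ?_⟩
  · rw [ZMod.lift_injective]
    intro m hm
    rw [ZMod.intCast_zmod_eq_zero_iff_dvd, Int.natAbs_dvd]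
    exact (hker m).1 hm
  · ext c
    simp only [AddMonoidHom.mem_range]
    constructor
    · rintro ⟨x, rfl⟩
      obtain ⟨m, rfl⟩ := ZMod.intCast_surjective x
      exact ⟨m, by simp⟩
    · rintro ⟨m, rfl⟩
      exact ⟨m, by simp⟩


/-- Exactness of `0 → A →f B →g ℤ →(·χ) ℤ →h C →k D → 0` with `χ ≠ 0` and `D` free
implies `f` is an isomorphism and `C ≃ ℤ/|χ|ℤ × D`. -/
theorem stmt_2 {A B C D : Type*} [AddCommGroup A] [AddCommGroup B]
    [AddCommGroup C] [AddCommGroup D]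
    (f : A →+ B) (g : B →+ ℤ) (h : ℤ →+ C) (k : C →+ D) (χ : ℤ) (hχ : χ ≠ 0)
    (hf : Function.Injective f)
    (hfg : f.range = g.ker)
    (hgχ : g.range = (zsmulAddGroupHom χ : ℤ →+ ℤ).ker)
    (hχh : (zsmulAddGroupHom χ : ℤ →+ ℤ).range = h.ker)
    (hhk : h.range = k.ker)
    (hk : Function.Surjective k)
    (hD : Module.Free ℤ D) :
    Function.Bijective f ∧ Nonempty (C ≃+ ZMod χ.natAbs × D) := by
  have hg (b : B) : g b = 0 := by
    have hb : g b ∈ (zsmulAddGroupHom χ : ℤ →+ ℤ).ker := hgχ ▸ ⟨b, rfl⟩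
    simpa [AddMonoidHom.mem_ker, hχ] using hb
  have hf' : Function.Surjective f := fun b => by
    have hb : b ∈ f.range := hfg ▸ hg b
    exact hb
  obtain ⟨i, hi, hir⟩ := exists_injective_zmod_of_ker_eq h χ hχh
  exact ⟨⟨hf, hf'⟩, nonempty_addEquiv_prod_of_exact_of_free i k hi (hir.trans hhk) hk⟩
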